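/- Let β > 0 and let k satisfy 4/(4+β) < k < 1. Then Q⁺⁻(k) = {(x,y,z) ∈ ℝ³ : β(x²y²+y²z²+z²x²) + (x²+y²+z²−1/2)² − (1−k)/4 = 0} has exactly six connected components, and each of these components is compact and homeomorphic to the 2-sphere. -/

import Mathlib

open Set

/-- The polynomial whose zero set is the quartic surface `Q⁺⁻(k)`. -/
noncomputable def quarticPoly (β k x y z : ℝ) : ℝ :=
  β * (x ^ 2 * y ^ 2 + y ^ 2 * z ^ 2 + z ^ 2 * x ^ 2) + (x ^ 2 + y ^ 2 + z ^ 2 - 1 / 2) ^ 2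
    - (1 - k) / 4

/-- In the affine coordinates `a = y / x`, `b = z / x`, `q = (k / 2 - u) / x ^ 2`, with
`u = x ^ 2 + y ^ 2 + z ^ 2`, the quartic surface is the zero set of `chartPoly β k a b q`. -/
noncomputable def chartPoly (β k a b q : ℝ) : ℝ :=
  (1 - k) * (1 + a ^ 2 + b ^ 2) ^ 2 - k * β * (a ^ 2 + b ^ 2 + a ^ 2 * b ^ 2) - q ^ 2

/-- The polynomial in `R` whose value at `r ^ 2` is `chartPoly β k (r * a) (r * b) (r * q)`. -/
noncomputable def rayPoly (β k a b q R : ℝ) : ℝ :=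
  (1 - k) * (1 + R * (a ^ 2 + b ^ 2)) ^ 2
    - k * β * (R * (a ^ 2 + b ^ 2) + R ^ 2 * (a ^ 2 * b ^ 2)) - R * q ^ 2

lemma chartPoly_smul (β k a b q r : ℝ) :
    chartPoly β k (r * a) (r * b) (r * q) = rayPoly β k a b q (r ^ 2) := by
  unfold chartPoly rayPoly; ring

lemma quarticPoly_eq_chartPoly (β k x a b q : ℝ)
    (hq : x ^ 2 * q = k / 2 - (x ^ 2 + (x * a) ^ 2 + (x * b) ^ 2)) :
    k * quarticPoly β k x (x * a) (x * b) = -(x ^ 4 * chartPoly β k a b q) := by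
  have h : x ^ 4 * q ^ 2 = (k / 2 - (x ^ 2 + (x * a) ^ 2 + (x * b) ^ 2)) ^ 2 := by
    rw [← hq]; ring
  unfold quarticPoly chartPoly
  linear_combination -h

section Parameters

variable {β k : ℝ}

lemma pos_of_four_div_lt (hβ : 0 < β) (hk0 : 4 / (4 + β) < k) : 0 < k :=
  lt_trans (by positivity) hk0

lemma four_mul_one_sub_lt (hβ : 0 < β) (hk0 : 4 / (4 + β) < k) : 4 * (1 - k) < k * β := by
  rw [div_lt_iff₀ (by positivity)] at hk0
  linarith

lemma rayPoly_neg_of_sq_eq_one (hβ : 0 < β) (hk0 : 4 / (4 + β) < k)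
    {a b q R : ℝ} (hR : 0 < R) (ha : R * a ^ 2 = 1) (hb : R * b ^ 2 ≤ 1) :
    rayPoly β k a b q R < 0 := by
  have h4 := four_mul_one_sub_lt hβ hk0
  have hk := pos_of_four_div_lt hβ hk0
  have e : rayPoly β k a b q R =
      (1 - k) * (2 + R * b ^ 2) ^ 2 - k * β * (1 + 2 * (R * b ^ 2)) - R * q ^ 2 := by
    unfold rayPoly
    linear_combination ((1 - k) * (R * a ^ 2 + 3 + 2 * (R * b ^ 2)) - k * β * (1 + R * b ^ 2)) * ha
  have hb0 : 0 ≤ R * b ^ 2 := by positivity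
  have hq0 : 0 ≤ R * q ^ 2 := by positivity
  rw [e]
  generalize R * b ^ 2 = c at *
  have hkb : 0 < k * β := by positivity
  have h1 : (1 - k) * (2 + c) ^ 2 < k * β / 4 * (2 + c) ^ 2 := by
    apply mul_lt_mul_of_pos_right <;> [linarith; positivity]
  nlinarith [mul_nonneg hkb.le (mul_nonneg hb0 (by linarith : 0 ≤ 4 - c))]

lemma rayPoly_swap (a b q R : ℝ) : rayPoly β k a b q R = rayPoly β k b a q R := by
  unfold rayPoly; ring

/-- Off the axis, each ray leaves the region where `rayPoly` is nonnegative before it leaves the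
square `a ^ 2 ≤ 1`, `b ^ 2 ≤ 1`. -/
lemma exists_rayPoly_neg (hβ : 0 < β) (hk0 : 4 / (4 + β) < k) (a b q : ℝ)
    (hab : ¬(a = 0 ∧ b = 0)) :
    ∃ R, 0 < R ∧ (R * a ^ 2 = 1 ∨ R * b ^ 2 = 1) ∧ R * a ^ 2 ≤ 1 ∧ R * b ^ 2 ≤ 1 ∧
      rayPoly β k a b q R < 0 := by
  wlog h : b ^ 2 ≤ a ^ 2 generalizing a b
  · have hab' : a ^ 2 ≤ b ^ 2 := (not_le.mp h).le
    obtain ⟨R, h1, h2, h3, h4, h5⟩ := this b a (fun hba => hab hba.symm) hab'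
    exact ⟨R, h1, h2.symm, h4, h3, by rwa [rayPoly_swap]⟩
  have ha : 0 < a ^ 2 := by
    rcases eq_or_ne a 0 with rfl | ha
    · exact absurd ⟨rfl, by nlinarith⟩ hab
    · positivity
  have h1 : (a ^ 2)⁻¹ * a ^ 2 = 1 := inv_mul_cancel₀ ha.ne'
  have h2 : (a ^ 2)⁻¹ * b ^ 2 ≤ 1 := by
    rw [← h1]; gcongr
  exact ⟨(a ^ 2)⁻¹, by positivity, .inl h1, h1.le, h2,
    rayPoly_neg_of_sq_eq_one hβ hk0 (by positivity) h1 h2⟩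

lemma exists_rayPoly_eq_zero (hβ : 0 < β) (hk0 : 4 / (4 + β) < k) (hk1 : k < 1) (a b q : ℝ)
    (h : ¬(a = 0 ∧ b = 0 ∧ q = 0)) :
    ∃ R, 0 < R ∧ R * a ^ 2 ≤ 1 ∧ R * b ^ 2 ≤ 1 ∧ rayPoly β k a b q R = 0 := by
  by_cases hab : a = 0 ∧ b = 0
  · obtain ⟨rfl, rfl⟩ := hab
    have hq : q ≠ 0 := by tauto
    have : 0 < 1 - k := by linarith
    refine ⟨(1 - k) / q ^ 2, by positivity, by simp, by simp, ?_⟩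
    unfold rayPoly
    field_simp
    ring
  · obtain ⟨R, hR, -, ha, hb, hneg⟩ := exists_rayPoly_neg hβ hk0 a b q hab
    have hcont : ContinuousOn (rayPoly β k a b q) (Icc 0 R) := by
      unfold rayPoly; fun_prop
    have h0 : 0 < rayPoly β k a b q 0 := by unfold rayPoly; norm_num; exact hk1
    obtain ⟨T, ⟨hT0, hTR⟩, hT⟩ := intermediate_value_Icc' hR.le hcont ⟨hneg.le, h0.le⟩
    have hT0' : 0 < T := by
      rcases hT0.eq_or_lt with rfl | h'
      · exact absurd hT h0.ne'
      · exact h'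
    exact ⟨T, hT0', (mul_le_mul_of_nonneg_right hTR (sq_nonneg a)).trans ha,
      (mul_le_mul_of_nonneg_right hTR (sq_nonneg b)).trans hb, hT⟩

lemma rayPoly_ne_zero_of_one_lt (hβ : 0 < β) (hk0 : 4 / (4 + β) < k) (hk1 : k < 1)
    {a b q R : ℝ} (h1 : rayPoly β k a b q 1 = 0) (hR : 1 < R)
    (ha : R * a ^ 2 < 1) (hb : R * b ^ 2 < 1) : rayPoly β k a b q R ≠ 0 := by
  intro hR0
  by_cases hab : a = 0 ∧ b = 0
  · obtain ⟨rfl, rfl⟩ := hab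
    unfold rayPoly at h1 hR0
    nlinarith
  · obtain ⟨T, hT, hT1, -, -, hneg⟩ := exists_rayPoly_neg hβ hk0 a b q hab
    have hRT : R < T := by
      rcases hT1 with h | h
      · exact lt_of_mul_lt_mul_right (by linarith) (sq_nonneg a)
      · exact lt_of_mul_lt_mul_right (by linarith) (sq_nonneg b)
    set C := (1 - k) * (a ^ 2 + b ^ 2) ^ 2 - k * β * (a ^ 2 * b ^ 2) with hC
    have hfac : ∀ S, rayPoly β k a b q S = C * ((S - 1) * (S - R)) := by
      intro S
      have h2 : (R - 1) * (rayPoly β k a b q S - C * ((S - 1) * (S - R))) = 0 := by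
        have : (R - 1) * (rayPoly β k a b q S - C * ((S - 1) * (S - R))) =
          (R - S) * rayPoly β k a b q 1 + (S - 1) * rayPoly β k a b q R := by
          rw [hC]; unfold rayPoly; ring
        rw [this, h1, hR0]; ring
      rcases mul_eq_zero.mp h2 with h | h <;> linarith
    have h0 : rayPoly β k a b q 0 = 1 - k := by unfold rayPoly; ring
    have hCpos : 0 < C := by
      rw [hfac] at h0
      by_contra hneg'
      nlinarith [mul_nonneg (neg_nonneg.mpr (not_lt.mp hneg')) (by linarith : 0 ≤ R)]
    rw [hfac] at hneg
    have : 0 < C * ((T - 1) * (T - R)) :=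
      mul_pos hCpos (mul_pos (by linarith) (by linarith))
    linarith

/-- The quartic surface does not meet the planes `|y| = |x|`. -/
lemma sq_ne_sq_of_quarticPoly (hβ : 0 < β) (hk0 : 4 / (4 + β) < k) {x y z : ℝ}
    (h : quarticPoly β k x y z = 0) (hz : z ^ 2 ≤ x ^ 2) : y ^ 2 ≠ x ^ 2 := by
  intro hy
  have hk := pos_of_four_div_lt hβ hk0
  have h4 := four_mul_one_sub_lt hβ hk0
  unfold quarticPoly at h
  rw [hy] at h
  have hz0 := sq_nonneg z
  generalize x ^ 2 = X at *
  generalize z ^ 2 = Z at *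
  have hX : 0 ≤ X := by linarith
  have e : (k / 2 - (X + X + Z)) ^ 2 + k * β * (X * X + X * Z + Z * X)
      = (1 - k) * (X + X + Z) ^ 2 := by linear_combination k * h
  have hXpos : 0 < X := by
    rcases hX.eq_or_lt with rfl | h'
    · obtain rfl : Z = 0 := by linarith
      nlinarith
    · exact h'
  have h1 : (1 - k) * (X + X + Z) ^ 2 < k * β / 4 * (X + X + Z) ^ 2 := by
    apply mul_lt_mul_of_pos_right <;> [linarith; positivity]
  nlinarith [sq_nonneg (k / 2 - (X + X + Z)),
    mul_nonneg (mul_pos hk hβ).le (mul_nonneg hz0 (by linarith : 0 ≤ 4 * X - Z))]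

lemma quarticPoly_swap (x y z : ℝ) : quarticPoly β k x y z = quarticPoly β k x z y := by
  unfold quarticPoly; ring

lemma abs_lt_of_quarticPoly (hβ : 0 < β) (hk0 : 4 / (4 + β) < k) {x y z : ℝ}
    (h : quarticPoly β k x y z = 0) (hy : |y| ≤ x) (hz : |z| ≤ x) : |y| < x ∧ |z| < x := by
  have hx : |x| = x := abs_of_nonneg ((abs_nonneg y).trans hy)
  have hy2 : y ^ 2 ≤ x ^ 2 := sq_le_sq.mpr (by rwa [hx])
  have hz2 : z ^ 2 ≤ x ^ 2 := sq_le_sq.mpr (by rwa [hx])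
  constructor
  · refine lt_of_le_of_ne hy fun e => sq_ne_sq_of_quarticPoly hβ hk0 h hz2 ?_
    rw [← e, sq_abs]
  · refine lt_of_le_of_ne hz fun e => sq_ne_sq_of_quarticPoly hβ hk0
      ((quarticPoly_swap x z y).trans h) hy2 ?_
    rw [← e, sq_abs]

/-- Coordinates of a point of the cap of the quartic surface around the positive `x`-axis. -/
structure IsCapPoint (β k x y z : ℝ) : Prop where
  eq_zero : quarticPoly β k x y z = 0
  abs_le₁ : |y| ≤ x
  abs_le₂ : |z| ≤ x

lemma IsCapPoint.pos (hβ : 0 < β) (hk0 : 4 / (4 + β) < k) {x y z : ℝ}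
    (h : IsCapPoint β k x y z) : 0 < x :=
  (abs_nonneg y).trans_lt (abs_lt_of_quarticPoly hβ hk0 h.eq_zero h.abs_le₁ h.abs_le₂).1

lemma IsCapPoint.exists_chart (hβ : 0 < β) (hk0 : 4 / (4 + β) < k) {x y z : ℝ}
    (h : IsCapPoint β k x y z) :
    ∃ a b q, y = x * a ∧ z = x * b ∧ x ^ 2 * q = k / 2 - (x ^ 2 + y ^ 2 + z ^ 2) ∧
      a ^ 2 < 1 ∧ b ^ 2 < 1 ∧ chartPoly β k a b q = 0 := by
  have hx := h.pos hβ hk0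
  obtain ⟨hy, hz⟩ := abs_lt_of_quarticPoly hβ hk0 h.eq_zero h.abs_le₁ h.abs_le₂
  obtain ⟨a, rfl⟩ : ∃ a, y = x * a := ⟨y / x, by field_simp⟩
  obtain ⟨b, rfl⟩ : ∃ b, z = x * b := ⟨z / x, by field_simp⟩
  have hq : x ^ 2 * ((k / 2 - (x ^ 2 + (x * a) ^ 2 + (x * b) ^ 2)) / x ^ 2)
    = k / 2 - (x ^ 2 + (x * a) ^ 2 + (x * b) ^ 2) := by field_simp
  refine ⟨a, b, _, rfl, rfl, hq, ?_, ?_, ?_⟩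
  · rw [abs_mul, abs_of_pos hx] at hy
    rw [sq_lt_one_iff_abs_lt_one]
    exact lt_of_mul_lt_mul_left (by linarith) hx.le
  · rw [abs_mul, abs_of_pos hx] at hz
    rw [sq_lt_one_iff_abs_lt_one]
    exact lt_of_mul_lt_mul_left (by linarith) hx.le
  · have := quarticPoly_eq_chartPoly β k x a b _ hq
    rw [h.eq_zero, mul_zero, eq_comm, neg_eq_zero] at this
    exact (mul_eq_zero.mp this).resolve_left (by positivity)

lemma eq_one_of_chartPoly (hβ : 0 < β) (hk0 : 4 / (4 + β) < k) (hk1 : k < 1)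
    {a b q r : ℝ} (hr : 0 < r) (h : chartPoly β k a b q = 0) (ha : a ^ 2 < 1) (hb : b ^ 2 < 1)
    (h' : chartPoly β k (r * a) (r * b) (r * q) = 0)
    (ha' : (r * a) ^ 2 < 1) (hb' : (r * b) ^ 2 < 1) : r = 1 := by
  wlog hr1 : 1 ≤ r generalizing a b q r
  · have hr' : r⁻¹ * r = 1 := inv_mul_cancel₀ hr.ne'
    have e : ∀ c, r⁻¹ * (r * c) = c := fun c => by rw [← mul_assoc, hr', one_mul]
    have := this (a := r * a) (b := r * b) (q := r * q) (r := r⁻¹) (by positivity) h' ha' hb'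
      (by simpa only [e] using h) (by simpa only [e] using ha) (by simpa only [e] using hb)
      ((one_le_inv₀ hr).mpr (not_le.mp hr1).le)
    exact inv_eq_one.mp this
  by_contra hne
  have hr1' : 1 < r := lt_of_le_of_ne hr1 (Ne.symm hne)
  rw [chartPoly_smul] at h'
  refine rayPoly_ne_zero_of_one_lt hβ hk0 hk1 (a := a) (b := b) (q := q) (R := r ^ 2)
    ?_ (by nlinarith) (by linarith [mul_pow r a 2]) (by linarith [mul_pow r b 2]) h'
  have := chartPoly_smul β k a b q 1
  simpa [h] using this.symm

lemma IsCapPoint.eq_of_smul (hβ : 0 < β) (hk0 : 4 / (4 + β) < k) (hk1 : k < 1)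
    {x y z x' y' z' c : ℝ} (h : IsCapPoint β k x y z) (h' : IsCapPoint β k x' y' z') (hc : 0 < c)
    (h₁ : x' * y' = c * (x * y)) (h₂ : x' * z' = c * (x * z))
    (h₃ : k / 2 - (x' ^ 2 + y' ^ 2 + z' ^ 2) = c * (k / 2 - (x ^ 2 + y ^ 2 + z ^ 2))) :
    x' = x ∧ y' = y ∧ z' = z := by
  have hx := h.pos hβ hk0
  have hx' := h'.pos hβ hk0
  have hk := pos_of_four_div_lt hβ hk0
  obtain ⟨a, b, q, rfl, rfl, hq, ha, hb, hp⟩ := h.exists_chart hβ hk0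
  obtain ⟨a', b', q', rfl, rfl, hq', ha', hb', hp'⟩ := h'.exists_chart hβ hk0
  obtain ⟨r, hr⟩ : ∃ r, r = c * x ^ 2 / x' ^ 2 := ⟨_, rfl⟩
  have hr0 : 0 < r := by rw [hr]; positivity
  have ea : a' = r * a := by
    rw [hr]; field_simp; linear_combination h₁
  have eb : b' = r * b := by
    rw [hr]; field_simp; linear_combination h₂
  have eq : q' = r * q := by
    rw [hr]; field_simp; linear_combination h₃ + hq' - c * hq
  subst ea eb eq
  obtain rfl := eq_one_of_chartPoly hβ hk0 hk1 hr0 hp ha hb hp' ha' hb'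
  simp only [one_mul] at *
  have hm : x ^ 2 * (q + 1 + a ^ 2 + b ^ 2) = k / 2 := by linear_combination hq
  have hm' : x' ^ 2 * (q + 1 + a ^ 2 + b ^ 2) = k / 2 := by linear_combination hq'
  have hne : q + 1 + a ^ 2 + b ^ 2 ≠ 0 := by
    intro h0; rw [h0] at hm; linarith
  have hxx : x' ^ 2 = x ^ 2 := mul_right_cancel₀ hne (hm'.trans hm.symm)
  obtain rfl : x' = x := (pow_left_inj₀ hx'.le hx.le two_ne_zero).mp hxx
  exact ⟨rfl, rfl, rfl⟩

lemma exists_isCapPoint (hβ : 0 < β) (hk0 : 4 / (4 + β) < k) (hk1 : k < 1) (A B D : ℝ)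
    (h : ¬(A = 0 ∧ B = 0 ∧ D = 0)) :
    ∃ x y z c, IsCapPoint β k x y z ∧ 0 < c ∧ x * y = c * A ∧ x * z = c * B ∧
      k / 2 - (x ^ 2 + y ^ 2 + z ^ 2) = c * D := by
  have hk := pos_of_four_div_lt hβ hk0
  obtain ⟨R, hR, ha, hb, h0⟩ := exists_rayPoly_eq_zero hβ hk0 hk1 A B D h
  obtain ⟨r, hr, rfl⟩ : ∃ r, 0 < r ∧ r ^ 2 = R := ⟨√R, Real.sqrt_pos.mpr hR, Real.sq_sqrt hR.le⟩
  rw [← chartPoly_smul] at h0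
  rw [← mul_pow] at ha hb
  obtain ⟨a, hae⟩ : ∃ a, a = r * A := ⟨_, rfl⟩
  obtain ⟨b, hbe⟩ : ∃ b, b = r * B := ⟨_, rfl⟩
  obtain ⟨q, hqe⟩ : ∃ q, q = r * D := ⟨_, rfl⟩
  rw [← hae, ← hbe, ← hqe] at h0
  rw [← hae] at ha
  rw [← hbe] at hb
  have hm : 0 < q + (1 + a ^ 2 + b ^ 2) := by
    have : q ^ 2 < (1 + a ^ 2 + b ^ 2) ^ 2 := by
      unfold chartPoly at h0
      have : 0 ≤ k * β * (a ^ 2 + b ^ 2 + a ^ 2 * b ^ 2) := by positivity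
      have : 0 < k * (1 + a ^ 2 + b ^ 2) ^ 2 := by positivity
      linarith
    linarith [(abs_lt_of_sq_lt_sq' this (by positivity)).1]
  obtain ⟨x, hx, hx2⟩ : ∃ x, 0 < x ∧ x ^ 2 * (q + (1 + a ^ 2 + b ^ 2)) = k / 2 := by
    refine ⟨√(k / 2 / (q + (1 + a ^ 2 + b ^ 2))), Real.sqrt_pos.mpr (by positivity), ?_⟩
    rw [Real.sq_sqrt (by positivity)]
    field_simp
  have hq : x ^ 2 * q = k / 2 - (x ^ 2 + (x * a) ^ 2 + (x * b) ^ 2) := by linear_combination hx2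
  refine ⟨x, x * a, x * b, x ^ 2 * r, ⟨?_, ?_, ?_⟩, by positivity, ?_, ?_, ?_⟩
  · have := quarticPoly_eq_chartPoly β k x a b q hq
    rw [h0, mul_zero, neg_zero] at this
    exact (mul_eq_zero.mp this).resolve_left hk.ne'
  · rw [abs_mul, abs_of_pos hx]
    exact mul_le_of_le_one_right hx.le (sq_le_one_iff_abs_le_one a |>.mp ha)
  · rw [abs_mul, abs_of_pos hx]
    exact mul_le_of_le_one_right hx.le (sq_le_one_iff_abs_le_one b |>.mp hb)
  · rw [hae]; ring
  · rw [hbe]; ring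
  · rw [← hq, hqe]; ring

end Parameters

section Surface

variable {β k : ℝ}

/-- The part of the quartic surface around the half-axis of sign `s` in direction `i`. -/
def quarticCap (β k : ℝ) (i : Fin 3) (s : ℤˣ) : Set (EuclideanSpace ℝ (Fin 3)) :=
  {p | IsCapPoint β k ((s : ℤ) * p i) (p (i + 1)) (p (i + 2))}

lemma sq_intUnit_mul (s : ℤˣ) (x : ℝ) : ((s : ℤ) * x) ^ 2 = x ^ 2 := by
  rcases Int.units_eq_one_or s with rfl | rfl <;> simp

lemma intUnit_mul_self (s : ℤˣ) (x : ℝ) : ((s : ℤ) : ℝ) * ((s : ℤ) * x) = x := by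
  rcases Int.units_eq_one_or s with rfl | rfl <;> simp

lemma quarticPoly_cyclic (p : EuclideanSpace ℝ (Fin 3)) (i : Fin 3) (s : ℤˣ) :
    quarticPoly β k ((s : ℤ) * p i) (p (i + 1)) (p (i + 2))
      = quarticPoly β k (p 0) (p 1) (p 2) := by
  unfold quarticPoly
  rw [sq_intUnit_mul]
  fin_cases i <;> simp <;> ring

lemma exists_euclideanSpace_cyclic (i : Fin 3) (x y z : ℝ) :
    ∃ p : EuclideanSpace ℝ (Fin 3), p i = x ∧ p (i + 1) = y ∧ p (i + 2) = z := by
  fin_cases i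
  · exact ⟨!₂[x, y, z], by simp⟩
  · exact ⟨!₂[z, x, y], by simp⟩
  · exact ⟨!₂[y, z, x], by simp⟩

lemma euclideanSpace_ext_cyclic (i : Fin 3) {p q : EuclideanSpace ℝ (Fin 3)} (h₀ : p i = q i)
    (h₁ : p (i + 1) = q (i + 1)) (h₂ : p (i + 2) = q (i + 2)) : p = q := by
  ext j
  fin_cases i <;> fin_cases j <;> assumption

lemma isClosed_quarticCap (i : Fin 3) (s : ℤˣ) : IsClosed (quarticCap β k i s) := by
  have : quarticCap β k i s =
      {p | quarticPoly β k ((s : ℤ) * p i) (p (i + 1)) (p (i + 2)) = 0} ∩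
        ({p | |p (i + 1)| ≤ ((s : ℤ) : ℝ) * p i} ∩ {p | |p (i + 2)| ≤ ((s : ℤ) : ℝ) * p i}) := by
    ext p
    exact ⟨fun h => ⟨h.1, h.2, h.3⟩, fun h => ⟨h.1, h.2.1, h.2.2⟩⟩
  rw [this]
  unfold quarticPoly
  refine (isClosed_eq (by fun_prop) (by fun_prop)).inter
    ((isClosed_le (by fun_prop) (by fun_prop)).inter (isClosed_le (by fun_prop) (by fun_prop)))

lemma isCompact_quarticCap (hβ : 0 < β) (hk0 : 4 / (4 + β) < k) (i : Fin 3) (s : ℤˣ) :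
    IsCompact (quarticCap β k i s) := by
  refine Metric.isCompact_of_isClosed_isBounded (isClosed_quarticCap i s)
    ((Metric.isBounded_closedBall (x := 0) (r := 1)).subset fun p hp => ?_)
  have h : quarticPoly β k (p 0) (p 1) (p 2) = 0 := (quarticPoly_cyclic p i s).symm.trans hp.1
  have hk := pos_of_four_div_lt hβ hk0
  rw [mem_closedBall_zero_iff, EuclideanSpace.norm_eq, Fin.sum_univ_three]
  simp only [Real.norm_eq_abs, sq_abs]
  refine Real.sqrt_le_iff.mpr ⟨zero_le_one, ?_⟩
  unfold quarticPoly at h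
  have : 0 ≤ β * ((p 0) ^ 2 * (p 1) ^ 2 + (p 1) ^ 2 * (p 2) ^ 2 + (p 2) ^ 2 * (p 0) ^ 2) := by
    positivity
  nlinarith

/-- Radially projected, this map is a homeomorphism from each cap to the unit sphere. -/
noncomputable def capMap (k : ℝ) (i : Fin 3) (s : ℤˣ) (p : EuclideanSpace ℝ (Fin 3)) :
    EuclideanSpace ℝ (Fin 3) :=
  !₂[(s : ℤ) * p i * p (i + 1), (s : ℤ) * p i * p (i + 2),
    k / 2 - (((s : ℤ) * p i) ^ 2 + p (i + 1) ^ 2 + p (i + 2) ^ 2)]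

lemma continuous_capMap (i : Fin 3) (s : ℤˣ) : Continuous (capMap k i s) := by
  unfold capMap
  refine (PiLp.continuous_toLp 2 _).comp (continuous_pi fun j => ?_)
  fin_cases j <;> simp <;> fun_prop

lemma capMap_ne_zero (hβ : 0 < β) (hk0 : 4 / (4 + β) < k) (hk1 : k < 1) {i : Fin 3} {s : ℤˣ}
    {p : EuclideanSpace ℝ (Fin 3)} (hp : p ∈ quarticCap β k i s) : capMap k i s p ≠ 0 := by
  intro h
  have hx := IsCapPoint.pos hβ hk0 hp
  have hk := pos_of_four_div_lt hβ hk0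
  have h0 := congrArg (· 0) h
  have h1 := congrArg (· 1) h
  have h2 := congrArg (· 2) h
  simp only [capMap, PiLp.toLp_apply, PiLp.zero_apply, Matrix.cons_val] at h0 h1 h2
  have e1 := (mul_eq_zero.mp h0).resolve_left hx.ne'
  have e2 := (mul_eq_zero.mp h1).resolve_left hx.ne'
  have e := hp.1
  unfold quarticPoly at e
  rw [e1, e2] at e h2
  nlinarith

lemma injOn_normalize_capMap (hβ : 0 < β) (hk0 : 4 / (4 + β) < k) (hk1 : k < 1)
    (i : Fin 3) (s : ℤˣ) :
    InjOn (fun p => ‖capMap k i s p‖⁻¹ • capMap k i s p) (quarticCap β k i s) := by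
  intro p hp q hq h
  have hp0 := norm_pos_iff.mpr (capMap_ne_zero hβ hk0 hk1 hp)
  have hq0 := norm_pos_iff.mpr (capMap_ne_zero hβ hk0 hk1 hq)
  have e : capMap k i s p = (‖capMap k i s p‖ * ‖capMap k i s q‖⁻¹) • capMap k i s q := by
    rw [mul_smul]
    exact (inv_smul_eq_iff₀ hp0.ne').mp h
  generalize hc : ‖capMap k i s p‖ * ‖capMap k i s q‖⁻¹ = c at e
  have hc0 : 0 < c := by rw [← hc]; positivity
  have h0 := congrArg (· 0) e
  have h1 := congrArg (· 1) e
  have h2 := congrArg (· 2) e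
  simp only [capMap, PiLp.toLp_apply, PiLp.smul_apply, Matrix.cons_val, smul_eq_mul] at h0 h1 h2
  obtain ⟨a, b, c⟩ := IsCapPoint.eq_of_smul hβ hk0 hk1 hq hp hc0 h0 h1 h2
  refine euclideanSpace_ext_cyclic i ?_ b c
  rw [← intUnit_mul_self s (p i), a, intUnit_mul_self]

lemma surjOn_normalize_capMap (hβ : 0 < β) (hk0 : 4 / (4 + β) < k) (hk1 : k < 1)
    (i : Fin 3) (s : ℤˣ) :
    SurjOn (fun p => ‖capMap k i s p‖⁻¹ • capMap k i s p) (quarticCap β k i s)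
      (Metric.sphere 0 1) := by
  intro w hw
  have hw1 : ‖w‖ = 1 := mem_sphere_zero_iff_norm.mp hw
  have hw0 : ¬(w 0 = 0 ∧ w 1 = 0 ∧ w 2 = 0) := by
    rintro ⟨h0, h1, h2⟩
    have : w = 0 := euclideanSpace_ext_cyclic 0 h0 h1 h2
    simp [this] at hw1
  obtain ⟨x, y, z, c, h, hc, h0, h1, h2⟩ := exists_isCapPoint hβ hk0 hk1 _ _ _ hw0
  obtain ⟨p, hx, rfl, rfl⟩ := exists_euclideanSpace_cyclic i ((s : ℤ) * x) y z
  obtain rfl : (s : ℤ) * p i = x := by rw [hx, intUnit_mul_self]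
  have e : capMap k i s p = c • w := by
    refine euclideanSpace_ext_cyclic 0 ?_ ?_ ?_
    · simpa [capMap] using h0
    · simpa [capMap] using h1
    · simpa [capMap] using h2
  refine ⟨p, h, ?_⟩
  simp only [e, norm_smul, hw1, mul_one, Real.norm_of_nonneg hc.le]
  exact inv_smul_smul₀ hc.ne' w

lemma nonempty_quarticCap_homeomorph_sphere (hβ : 0 < β) (hk0 : 4 / (4 + β) < k) (hk1 : k < 1)
    (i : Fin 3) (s : ℤˣ) :
    Nonempty (quarticCap β k i s ≃ₜ Metric.sphere (0 : EuclideanSpace ℝ (Fin 3)) 1) := by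
  have hmaps : MapsTo (fun p => ‖capMap k i s p‖⁻¹ • capMap k i s p) (quarticCap β k i s)
      (Metric.sphere 0 1) := fun p hp => mem_sphere_zero_iff_norm.mpr
    (norm_smul_inv_norm (𝕜 := ℝ) (capMap_ne_zero hβ hk0 hk1 hp))
  have hbij := BijOn.mk hmaps (injOn_normalize_capMap hβ hk0 hk1 i s)
    (surjOn_normalize_capMap hβ hk0 hk1 i s)
  have hcont : ContinuousOn (fun p => ‖capMap k i s p‖⁻¹ • capMap k i s p)
      (quarticCap β k i s) :=
    ((continuous_capMap i s).norm.continuousOn.inv₀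
      fun p hp => norm_ne_zero_iff.mpr (capMap_ne_zero hβ hk0 hk1 hp)).smul
      (continuous_capMap i s).continuousOn
  have : CompactSpace (quarticCap β k i s) :=
    isCompact_iff_compactSpace.mp (isCompact_quarticCap hβ hk0 i s)
  exact ⟨Continuous.homeoOfEquivCompactToT2 (f := hbij.equiv _) (hcont.mapsToRestrict hmaps)⟩

lemma isConnected_quarticCap (hβ : 0 < β) (hk0 : 4 / (4 + β) < k) (hk1 : k < 1)
    (i : Fin 3) (s : ℤˣ) : IsConnected (quarticCap β k i s) := by
  obtain ⟨e⟩ := nonempty_quarticCap_homeomorph_sphere hβ hk0 hk1 i s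
  have : ConnectedSpace (Metric.sphere (0 : EuclideanSpace ℝ (Fin 3)) 1) :=
    isConnected_iff_connectedSpace.mp (isConnected_sphere (by
      rw [← Module.finrank_eq_rank, finrank_euclideanSpace_fin]; norm_num) 0 zero_le_one)
  exact isConnected_iff_connectedSpace.mpr (e.symm.surjective.connectedSpace e.symm.continuous)

lemma disjoint_quarticCap (hβ : 0 < β) (hk0 : 4 / (4 + β) < k) {i j : Fin 3} {s t : ℤˣ}
    {p : EuclideanSpace ℝ (Fin 3)} (h : p ∈ quarticCap β k i s) (h' : p ∈ quarticCap β k j t) :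
    (i, s) = (j, t) := by
  have key : ∀ {i s}, p ∈ quarticCap β k i s → ∀ j ≠ i, |p j| < |p i| := by
    intro i s h j hj
    have hx : (s : ℤ) * p i = |p i| := by
      rw [← abs_of_pos (IsCapPoint.pos hβ hk0 h), abs_mul]
      rcases Int.units_eq_one_or s with rfl | rfl <;> simp
    obtain ⟨h1, h2⟩ := abs_lt_of_quarticPoly hβ hk0 h.1 h.2 h.3
    rw [hx] at h1 h2
    obtain rfl | rfl : j = i + 1 ∨ j = i + 2 := by clear * - hj; decide +revert
    · exact h1
    · exact h2
  obtain rfl : i = j := by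
    by_contra hij
    exact lt_asymm (key h j (Ne.symm hij)) (key h' i hij)
  have hs := IsCapPoint.pos hβ hk0 h
  have ht := IsCapPoint.pos hβ hk0 h'
  rcases Int.units_eq_one_or s with rfl | rfl <;> rcases Int.units_eq_one_or t with rfl | rfl <;>
    simp at hs ht ⊢ <;> linarith

lemma exists_mem_quarticCap {p : EuclideanSpace ℝ (Fin 3)}
    (h : quarticPoly β k (p 0) (p 1) (p 2) = 0) : ∃ i s, p ∈ quarticCap β k i s := by
  obtain ⟨i, hi⟩ := Finite.exists_max fun j => |p j|
  obtain ⟨s, hs⟩ : ∃ s : ℤˣ, (s : ℤ) * p i = |p i| := by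
    rcases abs_choice (p i) with h | h
    · exact ⟨1, by simp [h]⟩
    · exact ⟨-1, by simp [h]⟩
  exact ⟨i, s, (quarticPoly_cyclic p i s).trans h, hs ▸ hi _, hs ▸ hi _⟩

end Surface

section Components

variable {X ι : Type*} [TopologicalSpace X] [Finite ι] {U : ι → Set X}

/-- In a finite partition into closed sets, every part is clopen. -/
lemma isClopen_of_finite_closed_partition (hclosed : ∀ i, IsClosed (U i))
    (hdisj : ∀ i j x, x ∈ U i → x ∈ U j → i = j) (hcover : ∀ x, ∃ i, x ∈ U i) (i : ι) :
    IsClopen (U i) := by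
  refine ⟨hclosed i, ?_⟩
  have : U i = (⋃ j : {j // j ≠ i}, U j)ᶜ := by
    ext x
    simp only [mem_compl_iff, mem_iUnion, not_exists]
    refine ⟨fun hx j hj => j.2 (hdisj _ _ x hj hx), fun hx => ?_⟩
    obtain ⟨j, hj⟩ := hcover x
    by_contra hxi
    exact hx ⟨j, fun e => hxi (e ▸ hj)⟩ hj
  rw [this]
  exact (isClosed_iUnion_of_finite fun j : {j // j ≠ i} => hclosed j).isOpen_compl

lemma connectedComponent_eq_of_finite_closed_partition (hclosed : ∀ i, IsClosed (U i))
    (hdisj : ∀ i j x, x ∈ U i → x ∈ U j → i = j) (hcover : ∀ x, ∃ i, x ∈ U i)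
    (hconn : ∀ i, IsConnected (U i)) {i : ι} {x : X} (hx : x ∈ U i) :
    connectedComponent x = U i :=
  ((isClopen_of_finite_closed_partition hclosed hdisj hcover i).connectedComponent_subset
    hx).antisymm ((hconn i).isPreconnected.subset_connectedComponent hx)

lemma card_connectedComponents_of_finite_closed_partition (hclosed : ∀ i, IsClosed (U i))
    (hdisj : ∀ i j x, x ∈ U i → x ∈ U j → i = j) (hcover : ∀ x, ∃ i, x ∈ U i)
    (hconn : ∀ i, IsConnected (U i)) : Nat.card (ConnectedComponents X) = Nat.card ι := by
  have hcomp := fun i x => connectedComponent_eq_of_finite_closed_partition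
    hclosed hdisj hcover hconn (i := i) (x := x)
  choose f hf using fun i => (hconn i).nonempty
  refine (Nat.card_eq_of_bijective (fun i => (f i : ConnectedComponents X)) ⟨?_, ?_⟩).symm
  · intro i j h
    rw [ConnectedComponents.coe_eq_coe, hcomp i _ (hf i), hcomp j _ (hf j)] at h
    exact hdisj i j (f i) (hf i) (h ▸ hf i)
  · intro c
    obtain ⟨x, rfl⟩ := ConnectedComponents.surjective_coe c
    obtain ⟨i, hi⟩ := hcover x
    refine ⟨i, ?_⟩
    rw [ConnectedComponents.coe_eq_coe, hcomp i _ (hf i), hcomp i _ hi]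

end Components

/-- for `β > 0` and `4/(4+β) < k < 1`, the quartic `Q⁺⁻(k)` has exactly
six connected components, each compact and homeomorphic to the 2-sphere. -/
theorem stmt_14 (β k : ℝ) (hβ : 0 < β) (hk0 : 4/(4+β) < k) (hk1 : k < 1)
    (Q : Set (EuclideanSpace ℝ (Fin 3)))
    (hQ : Q = {p | β * ((p 0)^2*(p 1)^2 + (p 1)^2*(p 2)^2 + (p 2)^2*(p 0)^2)
        + ((p 0)^2 + (p 1)^2 + (p 2)^2 - 1/2)^2 - (1 - k)/4 = 0}) :
    Nat.card (ConnectedComponents ↥Q) = 6 ∧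
    ∀ p ∈ Q, IsCompact (connectedComponentIn Q p) ∧
      Nonempty (↥(connectedComponentIn Q p) ≃ₜ
        ↥(Metric.sphere (0 : EuclideanSpace ℝ (Fin 3)) 1)) := by
  have hQ' : ∀ p, p ∈ Q ↔ quarticPoly β k (p 0) (p 1) (p 2) = 0 := fun p => by rw [hQ]; rfl
  have hsub : ∀ i s, quarticCap β k i s ⊆ Q := fun i s p hp =>
    (hQ' p).mpr ((quarticPoly_cyclic p i s).symm.trans hp.1)
  let U : Fin 3 × ℤˣ → Set Q := fun a => Subtype.val ⁻¹' quarticCap β k a.1 a.2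
  have himage : ∀ a, Subtype.val '' U a = quarticCap β k a.1 a.2 := fun a =>
    Subtype.image_preimage_coe _ _ |>.trans (inter_eq_right.mpr (hsub _ _))
  have hclosed : ∀ a, IsClosed (U a) := fun a =>
    (isClosed_quarticCap a.1 a.2).preimage continuous_subtype_val
  have hdisj : ∀ a b x, x ∈ U a → x ∈ U b → a = b := fun a b x ha hb =>
    disjoint_quarticCap hβ hk0 ha hb
  have hcover : ∀ x, ∃ a, x ∈ U a := fun x => by
    obtain ⟨i, s, h⟩ := exists_mem_quarticCap ((hQ' x).mp x.2)
    exact ⟨(i, s), h⟩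
  have hconn : ∀ a, IsConnected (U a) := fun a => by
    have h := isConnected_quarticCap hβ hk0 hk1 a.1 a.2
    rw [← himage a] at h
    exact ⟨h.1.of_image, Topology.IsInducing.subtypeVal.isPreconnected_image.mp h.2⟩
  constructor
  · rw [card_connectedComponents_of_finite_closed_partition hclosed hdisj hcover hconn,
      Nat.card_eq_fintype_card]
    rfl
  · intro p hp
    obtain ⟨a, ha⟩ := hcover ⟨p, hp⟩
    rw [connectedComponentIn_eq_image hp, connectedComponent_eq_of_finite_closed_partition
      hclosed hdisj hcover hconn ha, himage]
    exact ⟨isCompact_quarticCap hβ hk0 _ _,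
      nonempty_quarticCap_homeomorph_sphere hβ hk0 hk1 _ _⟩
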